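/- Let R = ℚ[x_1, …, x_l] be a graded polynomial ring with generators x_i of positive even degrees ordered so that deg x_1 ≤ … ≤ deg x_l, and let y_1, …, y_l be homogeneous elements forming a regular sequence such that R/(y_1, …, y_l) is finite dimensional over ℚ. Then there exists a permutation σ of {1, …, l} such that for every j, the element y_{σ(j)} does not lie in the ideal generated by x_1, …, x_{j−1}. -/

import Mathlib

open MvPolynomial

noncomputable def killVars (l k : ℕ) : MvPolynomial (Fin l) ℚ →ₐ[ℚ] MvPolynomial (Fin l) ℚ :=
  aeval (fun i : Fin l => if (i : ℕ) < k then 0 else X i)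

lemma killVars_X (l k : ℕ) (i : Fin l) :
    killVars l k (X i) = if (i : ℕ) < k then 0 else X i := by
  simp [killVars]

lemma killVars_comp (l k : ℕ) (p : MvPolynomial (Fin l) ℚ) :
    killVars l (k + 1) (killVars l k p) = killVars l (k + 1) p := by
  have : (killVars l (k + 1)).comp (killVars l k) = killVars l (k + 1) := by
    ext1 i
    simp only [AlgHom.comp_apply, killVars_X]
    by_cases h : (i : ℕ) < k
    · simp [h, Nat.lt_succ_of_lt h]
    · simp [h, killVars_X]
  exact congrArg (fun f => f p) this

lemma le_height_ker (l : ℕ) : ∀ k : ℕ, k ≤ l →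
    (k : ℕ∞) ≤ (RingHom.ker (killVars l k)).height
  | 0, _ => by simp
  | k + 1, hk => by
    have ih := le_height_ker l k (by omega)
    have h1 : (RingHom.ker (killVars l k)).IsPrime := RingHom.ker_isPrime _
    have h2 : (RingHom.ker (killVars l (k + 1))).IsPrime := RingHom.ker_isPrime _
    have hlt : RingHom.ker (killVars l k) < RingHom.ker (killVars l (k + 1)) := by
      refine lt_of_le_of_ne ?_ ?_
      · intro p hp
        rw [RingHom.mem_ker] at hp ⊢
        rw [← killVars_comp, hp, map_zero]
      · intro h
        have hx : (X ⟨k, by omega⟩ : MvPolynomial (Fin l) ℚ) ∈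
            RingHom.ker (killVars l (k + 1)) := by
          simp [RingHom.mem_ker, killVars_X]
        rw [← h, RingHom.mem_ker, killVars_X] at hx
        simp at hx
    have := Ideal.height_add_one_le_of_lt_of_isPrime hlt
    push_cast
    exact (add_le_add_left ih 1).trans this

lemma killVars_last (l : ℕ) (p : MvPolynomial (Fin l) ℚ) :
    killVars l l p = C (constantCoeff p) := by
  have : (fun i : Fin l => if (i : ℕ) < l then (0 : MvPolynomial (Fin l) ℚ) else X i)
      = fun _ => 0 := by
    ext1 i; simp
  rw [killVars, this, aeval_zero']
  rfl

lemma const_zero (l : ℕ) (d : Fin l → ℕ) (hdpos : ∀ i, 0 < d i)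
    (p : MvPolynomial (Fin l) ℚ) (m : ℕ) (hp : p.IsWeightedHomogeneous d m)
    (hu : ¬ IsUnit p) : constantCoeff p = 0 := by
  by_contra h
  have hm : m = 0 := by
    have := hp (d := 0) (by simpa [constantCoeff_eq] using h)
    simpa using this.symm
  subst hm
  apply hu
  have : p = C (constantCoeff p) := by
    ext e
    rw [coeff_C]
    split_ifs with he
    · rw [← he]; rfl
    · by_contra hc
      have hw := hp hc
      apply he
      rw [Finsupp.weight_apply, Finsupp.sum_fintype _ _ (by simp)] at hw
      rw [Finset.sum_eq_zero_iff] at hw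
      ext i
      have h3 := hw i (Finset.mem_univ i)
      have h4 := hdpos i
      rw [smul_eq_mul, Nat.mul_eq_zero] at h3
      simp only [Finsupp.coe_zero, Pi.zero_apply]
      omega
  rw [this]
  exact (isUnit_iff_ne_zero.mpr h).map C

lemma key (l : ℕ) (d : Fin l → ℕ) (hdpos : ∀ i, 0 < d i)
    (y : Fin l → MvPolynomial (Fin l) ℚ)
    (hyhom : ∀ i, ∃ m : ℕ, (y i).IsWeightedHomogeneous d m)
    (hne : Ideal.span (Set.range y) ≠ ⊤)
    (hfin : FiniteDimensional ℚ
      (MvPolynomial (Fin l) ℚ ⧸ Ideal.span (Set.range y)))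
    (J : Finset (Fin l)) (B : Finset (Fin l))
    (hB : ∀ i, i ∉ B → y i ∈ Ideal.span ((fun i : Fin l =>
      (X i : MvPolynomial (Fin l) ℚ)) '' (J : Set (Fin l)))) :
    l ≤ J.card + B.card := by
  classical
  set s : Finset (MvPolynomial (Fin l) ℚ) := J.image X ∪ B.image y with hs
  have hP : (RingHom.ker (killVars l l)).IsPrime := RingHom.ker_isPrime _
  have hys : Ideal.span (Set.range y) ≤ Ideal.span (s : Set (MvPolynomial (Fin l) ℚ)) := by
    rw [Ideal.span_le]
    rintro _ ⟨i, rfl⟩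
    by_cases hi : i ∈ B
    · exact Ideal.subset_span (by simp only [hs]; push_cast; exact Or.inr ⟨i, hi, rfl⟩)
    · refine Ideal.span_mono ?_ (hB i hi)
      simp only [hs]; push_cast
      exact Set.subset_union_left
  have hmem : RingHom.ker (killVars l l) ∈
      (Ideal.span (s : Set (MvPolynomial (Fin l) ℚ))).minimalPrimes := by
    refine ⟨⟨hP, ?_⟩, ?_⟩
    · rw [Ideal.span_le]
      intro p hp
      simp only [hs] at hp
      push_cast at hp
      rcases hp with ⟨i, _, rfl⟩ | ⟨i, _, rfl⟩
      · simp [RingHom.mem_ker, killVars_X]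
      · obtain ⟨m, hm⟩ := hyhom i
        have := const_zero l d hdpos (y i) m hm (fun hu => hne
          (Ideal.eq_top_of_isUnit_mem _ (Ideal.subset_span ⟨i, rfl⟩) hu))
        simp [RingHom.mem_ker, killVars_last, this]
    · rintro q ⟨hq, hsq⟩ hqP
      have := hq
      have : IsArtinianRing (MvPolynomial (Fin l) ℚ ⧸ Ideal.span (Set.range y)) :=
        IsArtinianRing.of_finite ℚ _
      have hyq := hys.trans hsq
      have hker : RingHom.ker (Ideal.Quotient.mk (Ideal.span (Set.range y))) ≤ q := by
        rwa [Ideal.mk_ker]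
      have hpm := Ideal.map_isPrime_of_surjective
        (Ideal.Quotient.mk_surjective (I := Ideal.span (Set.range y))) hker
      have hmm : (q.map (Ideal.Quotient.mk (Ideal.span (Set.range y)))).IsMaximal :=
        IsArtinianRing.isMaximal_of_isPrime _
      have hqm : q.IsMaximal := by
        have := Ideal.comap_isMaximal_of_surjective _
          (Ideal.Quotient.mk_surjective (I := Ideal.span (Set.range y))) 
          (K := q.map (Ideal.Quotient.mk (Ideal.span (Set.range y))))
        rwa [Ideal.comap_map_of_surjective' _ Ideal.Quotient.mk_surjective,
          sup_eq_left.mpr hker] at this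
      exact (hqm.eq_of_le hP.ne_top hqP).ge
  have h1 := (le_height_ker l l le_rfl).trans
    (Ideal.height_le_card_of_mem_minimalPrimes_span_finset hmem)
  have h2 : l ≤ s.card := by exact_mod_cast h1
  exact h2.trans ((Finset.card_union_le _ _).trans
    (add_le_add Finset.card_image_le Finset.card_image_le))

theorem stmt5 (l : ℕ) (d : Fin l → ℕ) (hdpos : ∀ i, 0 < d i)
    (hdeven : ∀ i, Even (d i)) (hmono : Monotone d)
    (y : Fin l → MvPolynomial (Fin l) ℚ)
    (hyhom : ∀ i, ∃ m : ℕ, (y i).IsWeightedHomogeneous d m)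
    (hreg : RingTheory.Sequence.IsRegular (MvPolynomial (Fin l) ℚ) (List.ofFn y))
    (hfin : FiniteDimensional ℚ
      (MvPolynomial (Fin l) ℚ ⧸ Ideal.span (Set.range y))) :
    ∃ σ : Equiv.Perm (Fin l), ∀ j : Fin l,
      y (σ j) ∉ Ideal.span ((fun i : Fin l => (X i : MvPolynomial (Fin l) ℚ)) ''
        {i : Fin l | (i : ℕ) < (j : ℕ)}) := by
  classical
  have hne : Ideal.span (Set.range y) ≠ ⊤ := by
    intro h
    apply hreg.top_ne_smul
    have : Ideal.ofList (List.ofFn y) = ⊤ := by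
      rw [← h, Ideal.ofList]
      congr 1
      ext p
      simp [List.mem_ofFn]
    rw [this]
    simp
  let t : Fin l → Finset (Fin l) := fun j => Finset.univ.filter fun i =>
    y i ∉ Ideal.span ((fun i : Fin l => (X i : MvPolynomial (Fin l) ℚ)) ''
        {i : Fin l | (i : ℕ) < (j : ℕ)})
  have ht : ∀ j : Fin l, l ≤ (j : ℕ) + (t j).card := by
    intro j
    have := key l d hdpos y hyhom hne hfin (Finset.Iio j) (t j) (by
      intro i hi
      simp only [t, Finset.mem_filter, Finset.mem_univ, true_and, not_not] at hi
      convert hi using 3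
      ext a
      simp)
    simpa using this
  obtain ⟨f, hf, hft⟩ := (Finset.all_card_le_biUnion_card_iff_exists_injective t).mp (by
    intro S
    rcases S.eq_empty_or_nonempty with rfl | hS
    · simp
    · have h1 : S.card ≤ l - (S.min' hS : ℕ) := by
        have : S ⊆ Finset.Ici (S.min' hS) := fun x hx =>
          Finset.mem_Ici.mpr (S.min'_le x hx)
        simpa using Finset.card_le_card this
      have h2 := ht (S.min' hS)
      have h3 := Finset.card_le_card (Finset.subset_biUnion_of_mem t (S.min'_mem hS))
      omega)
  refine ⟨Equiv.ofBijective f (Finite.injective_iff_bijective.mp hf), fun j => ?_⟩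
  have := hft j
  simp only [t, Finset.mem_filter, Finset.mem_univ, true_and] at this
  simpa using this
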